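/- For every T ∈ SO⁺(3,1) there exists A ∈ SL(2,ℂ) with Φ(A) = T; moreover the only elements of SL(2,ℂ) mapping to T under Φ are A and −A. In other words, Φ : SL(2,ℂ) → SO⁺(3,1) is surjective and two-to-one. -/

import Mathlib

open Matrix Complex Finset

/-- The Pauli matrices σ₀, σ₁, σ₂, σ₃. -/
noncomputable def σm : Fin 4 → Matrix (Fin 2) (Fin 2) ℂ :=
  ![!![1, 0; 0, 1], !![0, 1; 1, 0], !![0, -I; I, 0], !![1, 0; 0, -1]]

/-- The totally antisymmetric symbol with ε₁₂₃ = 1 (on indices in {1,2,3} ⊂ {0,1,2,3}). -/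
noncomputable def eps (i j k : Fin 4) : ℂ :=
  if (i, j, k) = (1, 2, 3) ∨ (i, j, k) = (2, 3, 1) ∨ (i, j, k) = (3, 1, 2) then 1
  else if (i, j, k) = (1, 3, 2) ∨ (i, j, k) = (3, 2, 1) ∨ (i, j, k) = (2, 1, 3) then -1
  else 0

/-- Ψ : ℝ⁴ → M₂(ℂ), Ψ(x) = ∑ xⁱ σᵢ. -/
noncomputable def Ψ (x : Fin 4 → ℝ) : Matrix (Fin 2) (Fin 2) ℂ :=
  ∑ i, (x i : ℂ) • σm i

/-- The conjugated matrix A' = tr(A)·σ₀ − A (i.e. a⁰σ₀ − a¹σ₁ − a²σ₂ − a³σ₃). -/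
noncomputable def matConj (A : Matrix (Fin 2) (Fin 2) ℂ) : Matrix (Fin 2) (Fin 2) ℂ :=
  A.trace • (1 : Matrix (Fin 2) (Fin 2) ℂ) - A

/-- The inverse of Ψ (on Hermitian matrices): xⁱ = Re((1/2)·tr(σᵢ M)). -/
noncomputable def ΨInv (M : Matrix (Fin 2) (Fin 2) ℂ) : Fin 4 → ℝ :=
  fun i => ((1 / 2 : ℂ) * (σm i * M).trace).re

/-- Φ(A)(x) = Ψ⁻¹(A Ψ(x) A†). -/
noncomputable def Φ (A : Matrix (Fin 2) (Fin 2) ℂ) (x : Fin 4 → ℝ) : Fin 4 → ℝ :=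
  ΨInv (A * Ψ x * Aᴴ)

/-- The Minkowski norm ‖x‖² = (x⁰)² − (x¹)² − (x²)² − (x³)². -/
def mink (x : Fin 4 → ℝ) : ℝ := x 0 ^ 2 - x 1 ^ 2 - x 2 ^ 2 - x 3 ^ 2

/-- The Minkowski metric g = diag(1,−1,−1,−1). -/
def gM : Matrix (Fin 4) (Fin 4) ℝ := Matrix.diagonal ![1, -1, -1, -1]

/-- τ₍ᵢ₎(T) = ∑_{j,k} Tʲₖ σᵢ' σⱼ σᵢ σₖ. -/
noncomputable def τm (T : Matrix (Fin 4) (Fin 4) ℝ) (i : Fin 4) : Matrix (Fin 2) (Fin 2) ℂ :=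
  ∑ j, ∑ k, (T j k : ℂ) • (matConj (σm i) * σm j * σm i * σm k)

/-- The ℂ-linear extension of Ψ⁻¹: component i is (1/2)·tr(σᵢ M). -/
noncomputable def ΨInvC (M : Matrix (Fin 2) (Fin 2) ℂ) : Fin 4 → ℂ :=
  fun i => (1 / 2 : ℂ) * (σm i * M).trace

lemma Psi_eq (x : Fin 4 → ℝ) :
    Ψ x = !![(x 0 : ℂ) + x 3, x 1 - x 2 * I; x 1 + x 2 * I, x 0 - x 3] := by
  ext i j
  fin_cases i <;> fin_cases j <;> simp [Ψ, σm, Fin.sum_univ_four, sub_eq_add_neg]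

lemma PsiInv_Psi (x : Fin 4 → ℝ) : ΨInv (Ψ x) = x := by
  ext i
  fin_cases i <;> simp [Psi_eq, ΨInv, σm, Matrix.trace] <;> ring

lemma Psi_PsiInv {M : Matrix (Fin 2) (Fin 2) ℂ} (hM : M.IsHermitian) : Ψ (ΨInv M) = M := by
  have h00 := hM.apply 0 0
  have h01 := hM.apply 0 1
  have h11 := hM.apply 1 1
  simp only [Complex.ext_iff] at h00 h01 h11
  simp at h00 h01 h11
  ext i j
  fin_cases i <;> fin_cases j <;> apply Complex.ext <;>
    simp [Psi_eq, ΨInv, σm, vecMul, dotProduct, Fin.sum_univ_two, Matrix.trace] <;> linarith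

lemma Psi_isHermitian (x : Fin 4 → ℝ) : (Ψ x).IsHermitian := by
  ext i j
  fin_cases i <;> fin_cases j <;> simp [Psi_eq, sub_eq_add_neg]

lemma Psi_Phi (A : Matrix (Fin 2) (Fin 2) ℂ) (x : Fin 4 → ℝ) : Ψ (Φ A x) = A * Ψ x * Aᴴ :=
  Psi_PsiInv (isHermitian_mul_mul_conjTranspose A (Psi_isHermitian x))

lemma Psi_injective : Function.Injective Ψ :=
  Function.LeftInverse.injective PsiInv_Psi

lemma det_Psi (x : Fin 4 → ℝ) : (Ψ x).det = mink x := by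
  rw [Psi_eq, det_fin_two_of, mink]
  push_cast
  linear_combination (x 2 : ℂ) ^ 2 * I_sq

/-- The matrix of the linear map `Φ A` in the standard basis. -/
noncomputable def phiMatrix (A : Matrix (Fin 2) (Fin 2) ℂ) : Matrix (Fin 4) (Fin 4) ℝ :=
  Matrix.of fun i j => Φ A (Pi.single j 1) i

lemma phiMatrix_mulVec (A : Matrix (Fin 2) (Fin 2) ℂ) (x : Fin 4 → ℝ) :
    phiMatrix A *ᵥ x = Φ A x := by
  have hx : Ψ x = ∑ j, (x j : ℂ) • Ψ (Pi.single j 1) := by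
    ext i j
    fin_cases i <;> fin_cases j <;> simp [Psi_eq, Fin.sum_univ_four, sub_eq_add_neg]
  ext i
  simp only [mulVec, dotProduct, phiMatrix, Matrix.of_apply, Φ, ΨInv]
  rw [hx]
  simp only [Matrix.sum_mul, Matrix.trace_sum, Finset.mul_sum, Complex.re_sum,
    Matrix.mul_smul, Matrix.smul_mul, Matrix.trace_smul]
  refine Finset.sum_congr rfl fun j _ => ?_
  rw [smul_eq_mul, mul_left_comm, Complex.re_ofReal_mul, mul_comm]

lemma eq_of_mulVec_eq {m n R : Type*} [Fintype n] [DecidableEq n] [NonAssocSemiring R]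
    {S T : Matrix m n R} (h : ∀ x, S *ᵥ x = T *ᵥ x) : S = T :=
  Matrix.mulVec_injective (funext h)

lemma Phi_mul (A B : Matrix (Fin 2) (Fin 2) ℂ) (x : Fin 4 → ℝ) : Φ (A * B) x = Φ A (Φ B x) := by
  apply Psi_injective
  simp only [Psi_Phi, conjTranspose_mul, Matrix.mul_assoc]

lemma Phi_one (x : Fin 4 → ℝ) : Φ 1 x = x := by
  apply Psi_injective
  simp [Psi_Phi]

lemma phiMatrix_mul (A B : Matrix (Fin 2) (Fin 2) ℂ) :
    phiMatrix (A * B) = phiMatrix A * phiMatrix B :=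
  eq_of_mulVec_eq fun x => by
    rw [← Matrix.mulVec_mulVec]
    simp only [phiMatrix_mulVec, Phi_mul]

lemma phiMatrix_one : phiMatrix 1 = 1 :=
  eq_of_mulVec_eq fun x => by rw [phiMatrix_mulVec, Phi_one, one_mulVec]

lemma mink_Phi {A : Matrix (Fin 2) (Fin 2) ℂ} (hA : A.det = 1) (x : Fin 4 → ℝ) :
    mink (Φ A x) = mink x := by
  have h : ((mink (Φ A x) : ℝ) : ℂ) = mink x := by
    rw [← det_Psi, ← det_Psi, Psi_Phi, det_mul, det_mul, det_conjTranspose, hA]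
    simp
  exact_mod_cast h

open scoped Kronecker in
lemma det_phiMatrix {A : Matrix (Fin 2) (Fin 2) ℂ} (hA : A.det = 1) : (phiMatrix A).det = 1 := by
  let P : Matrix (Fin 2 × Fin 2) (Fin 4) ℂ := Matrix.of fun p i => σm i p.1 p.2
  let Q : Matrix (Fin 4) (Fin 2 × Fin 2) ℂ := Matrix.of fun i p => (1 / 2 : ℂ) * σm i p.2 p.1
  have hPQ : P * Q = 1 := by
    ext ⟨a, b⟩ ⟨c, d⟩
    fin_cases a <;> fin_cases b <;> fin_cases c <;> fin_cases d <;>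
      simp [P, Q, Matrix.mul_apply, Fin.sum_univ_four, σm, mul_left_comm I] <;> norm_num
  have hQP : Q * P = 1 := by
    ext i j
    fin_cases i <;> fin_cases j <;>
      simp [P, Q, Matrix.mul_apply, Fintype.sum_prod_type, Fin.sum_univ_two, σm,
        mul_assoc] <;> norm_num
  have hconj : P * (phiMatrix A).map Complex.ofRealHom = (A ⊗ₖ A.map (starRingEnd ℂ)) * P := by
    ext ⟨a, b⟩ j
    have h := congrFun (congrFun (Psi_Phi A (Pi.single j 1)) a) b
    have hs : Ψ (Pi.single j 1) = σm j := by
      simp [Ψ, Pi.single_apply]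
    rw [hs] at h
    simp only [Ψ, Matrix.sum_apply, Matrix.smul_apply, smul_eq_mul] at h
    simp only [P, Matrix.mul_apply, Matrix.of_apply, Matrix.map_apply, phiMatrix,
      Complex.ofRealHom_eq_coe, Matrix.kroneckerMap_apply, Fintype.sum_prod_type]
    simp only [mul_comm (σm _ a b), h]
    simp only [Matrix.mul_apply, Fin.sum_univ_two, conjTranspose_apply, starRingEnd_apply]
    ring
  have hdet : ((phiMatrix A).map Complex.ofRealHom).det = 1 := by
    rw [← Matrix.det_conj_of_mul_eq_one hPQ hQP, hconj, Matrix.mul_assoc, hPQ, Matrix.mul_one,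
      Matrix.det_kronecker, hA]
    have : (A.map (starRingEnd ℂ)).det = starRingEnd ℂ A.det := (RingHom.map_det _ _).symm
    rw [this, hA]
    simp
  rw [← RingHom.mapMatrix_apply, ← RingHom.map_det] at hdet
  exact Complex.ofReal_injective (by simpa using hdet)

lemma exists_Psi_eq_of_mink_eq_zero {x : Fin 4 → ℝ} (hx : mink x = 0) (h0 : 0 ≤ x 0) :
    ∃ a b : ℂ, Ψ x = !![a * star a, a * star b; b * star a, b * star b] := by
  unfold mink at hx
  have hs : 0 ≤ x 0 + x 3 := by nlinarith [sq_nonneg (x 1), sq_nonneg (x 2)]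
  have hd : 0 ≤ x 0 - x 3 := by nlinarith [sq_nonneg (x 1), sq_nonneg (x 2)]
  rcases hs.eq_or_lt with hs | hs
  · have h1 : x 1 = 0 := by nlinarith [sq_nonneg (x 1), sq_nonneg (x 2)]
    have h2 : x 2 = 0 := by nlinarith [sq_nonneg (x 1), sq_nonneg (x 2)]
    refine ⟨0, (√(x 0 - x 3) : ℝ), ?_⟩
    have hr : (x 0 : ℂ) + x 3 = 0 := by exact_mod_cast hs.symm
    rw [Psi_eq, h1, h2, hr]
    simp [← Complex.ofReal_mul, Real.mul_self_sqrt hd]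
  · have hr : ((√(x 0 + x 3) : ℝ) : ℂ) ≠ 0 := by
      exact_mod_cast (Real.sqrt_pos.2 hs).ne'
    have hr2 : ((√(x 0 + x 3) : ℝ) : ℂ) ^ 2 = x 0 + x 3 := by
      exact_mod_cast Real.sq_sqrt hs.le
    have hx' : (x 0 : ℂ) ^ 2 - x 1 ^ 2 - x 2 ^ 2 - x 3 ^ 2 = 0 := by exact_mod_cast hx
    refine ⟨(√(x 0 + x 3) : ℝ), (x 1 + x 2 * I) / (√(x 0 + x 3) : ℝ), ?_⟩
    rw [Psi_eq]
    ext i j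
    fin_cases i <;> fin_cases j <;> simp <;> field_simp <;> try rw [hr2]
    · ring
    · linear_combination hx' + (x 2 : ℂ) ^ 2 * I_sq

lemma mink_mulVec {T : Matrix (Fin 4) (Fin 4) ℝ} (hg : Tᵀ * gM * T = gM) (x : Fin 4 → ℝ) :
    mink (T *ᵥ x) = mink x := by
  have h (y : Fin 4 → ℝ) : mink y = y ⬝ᵥ gM *ᵥ y := by
    simp [mink, gM, dotProduct, Fin.sum_univ_four, Matrix.mulVec_diagonal]
    ring
  rw [h, h]
  nth_rw 2 [← hg]
  rw [← mulVec_mulVec, ← mulVec_mulVec, dotProduct_mulVec x Tᵀ, vecMul_transpose]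

lemma gM_mul_gM : gM * gM = 1 := by
  ext i j
  fin_cases i <;> fin_cases j <;> simp [gM]

lemma abs_lt_of_lorentz {T : Matrix (Fin 4) (Fin 4) ℝ} (hg : Tᵀ * gM * T = gM)
    (hpos : 0 < T 0 0) : |T 0 3| < T 0 0 := by
  have h1 : (gM * Tᵀ * gM) * T = 1 := by
    rw [Matrix.mul_assoc gM, Matrix.mul_assoc gM, hg, gM_mul_gM]
  have h2 := congrFun (congrFun (mul_eq_one_comm (a := gM * Tᵀ * gM).1 h1) 0) 0
  simp [gM, Matrix.mul_apply, Fin.sum_univ_four, Matrix.diagonal_apply] at h2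
  apply abs_lt_of_sq_lt_sq _ hpos.le
  nlinarith [sq_nonneg (T 0 1), sq_nonneg (T 0 2)]

/-- A Lorentz transformation agrees with some `Φ A` on the plane spanned by `e₀` and `e₃`. -/
lemma exists_Phi_eq_on_plane {T : Matrix (Fin 4) (Fin 4) ℝ} (hg : Tᵀ * gM * T = gM)
    (hpos : 0 < T 0 0) : ∃ A : Matrix (Fin 2) (Fin 2) ℂ, A.det = 1 ∧
      Φ A (Pi.single 0 1) = T *ᵥ Pi.single 0 1 ∧ Φ A (Pi.single 3 1) = T *ᵥ Pi.single 3 1 := by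
  have habs := abs_lt.1 (abs_lt_of_lorentz hg hpos)
  obtain ⟨a, b, hab⟩ := exists_Psi_eq_of_mink_eq_zero (x := T *ᵥ ![1 / 2, 0, 0, 1 / 2])
    (by rw [mink_mulVec hg]; simp [mink])
    (by simp [mulVec, dotProduct, Fin.sum_univ_four]; linarith)
  obtain ⟨c, d, hcd⟩ := exists_Psi_eq_of_mink_eq_zero (x := T *ᵥ ![1 / 2, 0, 0, -(1 / 2)])
    (by rw [mink_mulVec hg]; simp [mink])
    (by simp [mulVec, dotProduct, Fin.sum_univ_four]; linarith)
  have hadd (x y : Fin 4 → ℝ) : Ψ (x + y) = Ψ x + Ψ y := by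
    simp [Ψ, add_smul, Finset.sum_add_distrib]
  have hsub (x y : Fin 4 → ℝ) : Ψ (x - y) = Ψ x - Ψ y := by
    simp [Ψ, sub_smul, Finset.sum_sub_distrib]
  have he0 : (Pi.single 0 1 : Fin 4 → ℝ) = ![1 / 2, 0, 0, 1 / 2] + ![1 / 2, 0, 0, -(1 / 2)] := by
    ext i; fin_cases i <;> simp; norm_num
  have he3 : (Pi.single 3 1 : Fin 4 → ℝ) = ![1 / 2, 0, 0, 1 / 2] - ![1 / 2, 0, 0, -(1 / 2)] := by
    ext i; fin_cases i <;> simp; norm_num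
  have hδ : (a * d - b * c) * star (a * d - b * c) = 1 := by
    have h := det_Psi (T *ᵥ Pi.single 0 1)
    rw [mink_mulVec hg, show mink (Pi.single 0 1) = 1 by simp [mink], he0, mulVec_add, hadd, hab,
      hcd, Complex.ofReal_one] at h
    simp [det_fin_two] at h
    rw [← h]
    simp
    ring
  obtain ⟨δ, hδdef⟩ : ∃ δ, δ = a * d - b * c := ⟨_, rfl⟩
  rw [← hδdef] at hδ
  have hδ' : star δ * δ = 1 := by rw [mul_comm, hδ]
  have e0 : Ψ (Pi.single 0 1) = !![1, 0; 0, 1] := by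
    rw [Psi_eq]; simp
  have e3 : Ψ (Pi.single 3 1) = !![1, 0; 0, -1] := by
    rw [Psi_eq]; simp
  refine ⟨!![a, c * star δ; b, d * star δ], ?_, ?_, ?_⟩
  · rw [det_fin_two_of, ← hδ', hδdef]
    ring
  · apply Psi_injective
    rw [Psi_Phi, e0, he0, mulVec_add, hadd, hab, hcd]
    ext i j
    fin_cases i <;> fin_cases j <;> simp [Matrix.mul_apply, Fin.sum_univ_two] at hδ ⊢
    · linear_combination c * starRingEnd ℂ c * hδ
    · linear_combination c * starRingEnd ℂ d * hδ
    · linear_combination d * starRingEnd ℂ c * hδ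
    · linear_combination d * starRingEnd ℂ d * hδ
  · apply Psi_injective
    rw [Psi_Phi, e3, he3, mulVec_sub, hsub, hab, hcd]
    ext i j
    fin_cases i <;> fin_cases j <;> simp [Matrix.mul_apply, Fin.sum_univ_two] at hδ ⊢
    · linear_combination -c * starRingEnd ℂ c * hδ
    · linear_combination -c * starRingEnd ℂ d * hδ
    · linear_combination -d * starRingEnd ℂ c * hδ
    · linear_combination -d * starRingEnd ℂ d * hδ

/-- A proper isometry fixing `e₀` and `e₃` is the image of a diagonal unitary matrix. -/
lemma exists_phiMatrix_eq_of_fixes {S : Matrix (Fin 4) (Fin 4) ℝ}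
    (hS : ∀ x, mink (S *ᵥ x) = mink x) (hdet : S.det = 1)
    (h0 : S *ᵥ Pi.single 0 1 = Pi.single 0 1) (h3 : S *ᵥ Pi.single 3 1 = Pi.single 3 1) :
    ∃ U : Matrix (Fin 2) (Fin 2) ℂ, U.det = 1 ∧ phiMatrix U = S := by
  have c0 (i) : S i 0 = (Pi.single 0 1 : Fin 4 → ℝ) i := by simpa using congrFun h0 i
  have c3 (i) : S i 3 = (Pi.single 3 1 : Fin 4 → ℝ) i := by simpa using congrFun h3 i
  have key (t x y z : ℝ) := hS ![t, x, y, z]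
  simp [mink, mulVec, dotProduct, Fin.sum_univ_four, c0, c3] at key
  have k1 := key 0 1 0 0
  have k2 := key 0 0 1 0
  have k01 := key 1 1 0 0
  have k02 := key 1 0 1 0
  have k31 := key 0 1 0 1
  have k32 := key 0 0 1 1
  simp at k1 k2 k01 k02 k31 k32
  have s01 : S 0 1 = 0 := by linarith
  have s02 : S 0 2 = 0 := by linarith
  have s31 : S 3 1 = 0 := by linarith
  have s32 : S 3 2 = 0 := by linarith
  have hd : S 1 1 * S 2 2 - S 1 2 * S 2 1 = 1 := by
    rw [← hdet]
    simp [Matrix.det_succ_row_zero, Fin.sum_univ_succ, Fin.succAbove, c0, c3, s31, s32]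
    ring
  rw [s01, s31] at k1
  rw [s02, s32] at k2
  have hsum : (S 2 2 - S 1 1) ^ 2 + (S 1 2 + S 2 1) ^ 2 = 0 := by linarith
  obtain ⟨hs1, hs2⟩ := (add_eq_zero_iff_of_nonneg (sq_nonneg _) (sq_nonneg _)).1 hsum
  have s22 : S 2 2 = S 1 1 := sub_eq_zero.1 (sq_eq_zero_iff.1 hs1)
  have s12 : S 1 2 = -S 2 1 := eq_neg_of_add_eq_zero_left (sq_eq_zero_iff.1 hs2)
  obtain ⟨u, hu⟩ := IsAlgClosed.exists_pow_nat_eq ((S 1 1 : ℂ) - S 2 1 * I) (n := 2) two_pos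
  have hnorm : u * star u = 1 := by
    have h1 : ‖u‖ ^ 2 = 1 := by
      rw [← pow_eq_one_iff_of_nonneg (sq_nonneg _) two_ne_zero, ← norm_pow, hu, Complex.sq_norm,
        Complex.normSq_apply]
      simp
      linarith
    rw [Complex.star_def, Complex.mul_conj, Complex.normSq_eq_norm_sq, h1, Complex.ofReal_one]
  have hu' : star u ^ 2 = (S 1 1 : ℂ) + S 2 1 * I := by
    rw [← star_pow, hu]
    simp
  refine ⟨!![u, 0; 0, star u], by simpa [det_fin_two_of] using hnorm, ?_⟩
  refine eq_of_mulVec_eq fun x => ?_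
  rw [phiMatrix_mulVec]
  apply Psi_injective
  rw [Psi_Phi]
  ext i j
  fin_cases i <;> fin_cases j <;>
    simp [Psi_eq, Matrix.mul_apply, mulVec, dotProduct, Fin.sum_univ_four, Fin.sum_univ_two, c0, c3,
      s01, s02, s31, s32, s22, s12] at hnorm hu' ⊢
  · linear_combination ((x 0 : ℂ) + x 3) * hnorm
  · linear_combination ((x 1 : ℂ) - x 2 * I) * hu + (S 2 1 : ℂ) * x 2 * I_sq
  · linear_combination ((x 1 : ℂ) + x 2 * I) * hu' + (S 2 1 : ℂ) * x 2 * I_sq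
  · linear_combination ((x 0 : ℂ) - x 3) * hnorm

lemma exists_phiMatrix_eq {T : Matrix (Fin 4) (Fin 4) ℝ} (hg : Tᵀ * gM * T = gM)
    (hdet : T.det = 1) (hpos : 0 < T 0 0) :
    ∃ A : Matrix (Fin 2) (Fin 2) ℂ, A.det = 1 ∧ phiMatrix A = T := by
  obtain ⟨A, hA, hA0, hA3⟩ := exists_Phi_eq_on_plane hg hpos
  have hunit : IsUnit A.det := by simp [hA]
  have hAinv : A⁻¹.det = 1 := by simp [det_nonsing_inv, hA]
  have hfix {x : Fin 4 → ℝ} (h : Φ A x = T *ᵥ x) : (phiMatrix A⁻¹ * T) *ᵥ x = x := by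
    rw [← mulVec_mulVec, ← h, phiMatrix_mulVec, ← Phi_mul, nonsing_inv_mul _ hunit, Phi_one]
  obtain ⟨U, hU, hUS⟩ := exists_phiMatrix_eq_of_fixes (S := phiMatrix A⁻¹ * T)
    (fun x => by rw [← mulVec_mulVec, phiMatrix_mulVec, mink_Phi hAinv, mink_mulVec hg])
    (by rw [det_mul, det_phiMatrix hAinv, hdet, one_mul]) (hfix hA0) (hfix hA3)
  refine ⟨A * U, by rw [det_mul, hA, hU, one_mul], ?_⟩
  rw [phiMatrix_mul, hUS, ← Matrix.mul_assoc, ← phiMatrix_mul, mul_nonsing_inv _ hunit,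
    phiMatrix_one, Matrix.one_mul]

lemma eq_one_or_neg_one_of_phiMatrix_eq_one {C : Matrix (Fin 2) (Fin 2) ℂ} (hC : C.det = 1)
    (h : phiMatrix C = 1) : C = 1 ∨ C = -1 := by
  have hfix (x : Fin 4 → ℝ) : C * Ψ x * Cᴴ = Ψ x := by
    rw [← Psi_Phi, ← phiMatrix_mulVec, h, one_mulVec]
  have e0 : Ψ (Pi.single 0 1) = 1 := by
    rw [Psi_eq]; simp [Matrix.one_fin_two]
  have hunit : Cᴴ * C = 1 := by
    apply mul_eq_one_comm.1
    simpa [e0] using hfix (Pi.single 0 1)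
  have hcomm (x : Fin 4 → ℝ) : C * Ψ x = Ψ x * C := by
    conv_rhs => rw [← hfix x]
    rw [Matrix.mul_assoc _ Cᴴ, hunit, Matrix.mul_one]
  have h1 := hcomm (Pi.single 1 1)
  have h3 := hcomm (Pi.single 3 1)
  have h01 := congrFun (congrFun h3 0) 1
  have h10 := congrFun (congrFun h3 1) 0
  have h11 := congrFun (congrFun h1 0) 1
  simp [Psi_eq, Matrix.mul_apply, Fin.sum_univ_two] at h01 h10 h11
  have c01 : C 0 1 = 0 := by linear_combination -(1 / 2 : ℂ) * h01
  have c10 : C 1 0 = 0 := by linear_combination (1 / 2 : ℂ) * h10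
  rw [det_fin_two, c01, ← h11] at hC
  have hsq : (C 0 0) ^ 2 = 1 := by linear_combination hC
  refine (by simpa using hsq : C 0 0 = 1 ∨ C 0 0 = -1).imp (fun h => ?_) fun h => ?_ <;>
    ext i j <;> fin_cases i <;> fin_cases j <;> simp [c01, c10, ← h11, h]

/-- Φ : SL(2,ℂ) → SO⁺(3,1) is surjective and two-to-one: every T ∈ SO⁺(3,1) is
Φ(A) for some A ∈ SL(2,ℂ), and the only preimages of T are A and −A. -/
theorem Phi_surjective_two_to_one (T : Matrix (Fin 4) (Fin 4) ℝ)
    (hg : Tᵀ * gM * T = gM) (hdet : T.det = 1) (hpos : 0 < T 0 0) :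
    ∃ A : Matrix (Fin 2) (Fin 2) ℂ, A.det = 1 ∧
      (∀ (x : Fin 4 → ℝ) (i : Fin 4), Φ A x i = ∑ j, T i j * x j) ∧
      ∀ B : Matrix (Fin 2) (Fin 2) ℂ, B.det = 1 →
        (∀ (x : Fin 4 → ℝ) (i : Fin 4), Φ B x i = ∑ j, T i j * x j) →
        B = A ∨ B = -A := by
  obtain ⟨A, hA, hAT⟩ := exists_phiMatrix_eq hg hdet hpos
  refine ⟨A, hA, fun x i => by rw [← phiMatrix_mulVec, hAT]; rfl, fun B hB hBT => ?_⟩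
  have hBT' : phiMatrix B = T := eq_of_mulVec_eq fun x => by
    rw [phiMatrix_mulVec]
    exact funext (hBT x)
  have hunit : IsUnit A.det := by simp [hA]
  have h1 : phiMatrix (A⁻¹ * B) = 1 := by
    rw [phiMatrix_mul, hBT', ← hAT, ← phiMatrix_mul, Matrix.nonsing_inv_mul _ hunit, phiMatrix_one]
  have hB' : B = A * (A⁻¹ * B) := by
    rw [← Matrix.mul_assoc, Matrix.mul_nonsing_inv _ hunit, Matrix.one_mul]
  rcases eq_one_or_neg_one_of_phiMatrix_eq_one (by simp [det_nonsing_inv, hA, hB]) h1 with h | h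
  · left; rw [hB', h, Matrix.mul_one]
  · right; rw [hB', h, Matrix.mul_neg, Matrix.mul_one]
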